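/- arXiv:2510.24966 — 2 statements merged into one kernel-verified Lean document; each statement's English description precedes it below -/
import Mathlib

section
/- Let M be a language model over sequences of length T over a finite alphabet Σ assigning positive probability to every sequence. Then M is expressible as a time-varying ISAN with hidden dimension d if and only if the extended logit matrix L_M(Σ^t, Σ^{≤T−t}) has rank at most d for all t ∈ {0,1,…,T−1}. -/
/-- The softmax distribution on a finite type associated to a vector `v`. -/
noncomputable def softmaxF {S : Type*} [Fintype S] (v : S → ℝ) (z : S) : ℝ :=
  Real.exp (v z) / ∑ z', Real.exp (v z')

/-- Hidden states of a time-varying ISAN along the token sequence `z`. -/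
noncomputable def tvState {S : Type*} {d : ℕ}
    (A : S → ℕ → Matrix (Fin d) (Fin d) ℝ) (x0 : Fin d → ℝ) (z : ℕ → S) :
    ℕ → Fin d → ℝ
  | 0 => x0
  | t + 1 => (A (z t) t).mulVec (tvState A x0 z t)

/-- Probability that a time-varying ISAN of sequence length `T` generates the tokens
`z 0, …, z (T-1)`. -/
noncomputable def tvProb {S : Type*} [Fintype S] {d : ℕ} (T : ℕ)
    (A : S → ℕ → Matrix (Fin d) (Fin d) ℝ) (B : ℕ → Matrix S (Fin d) ℝ)
    (x0 : Fin d → ℝ) (z : ℕ → S) : ℝ :=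
  ∏ t ∈ Finset.range T, softmaxF ((B t).mulVec (tvState A x0 z t)) (z t)

/-- Extend a finite sequence to `ℕ → S` (junk beyond `T`). -/
noncomputable def extSeq {S : Type*} [Nonempty S] {T : ℕ} (z : Fin T → S) : ℕ → S :=
  fun k => if h : k < T then z ⟨k, h⟩ else Classical.arbitrary S

/-- Probability under the language model `M` (a distribution on `Σ^T`) that the generated
sequence has the list `y` as a prefix. -/
noncomputable def prefProb {S : Type*} [Fintype S] [DecidableEq S] {T : ℕ}
    (M : (Fin T → S) → ℝ) (y : List S) : ℝ :=
  ∑ z ∈ Finset.univ.filter (fun z : Fin T → S => (List.ofFn z).take y.length = y), M z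

/-- Conditional probability `Pr_M[z ∣ y]` that the next token after the prefix `y` is `z`. -/
noncomputable def condProb {S : Type*} [Fintype S] [DecidableEq S] {T : ℕ}
    (M : (Fin T → S) → ℝ) (y : List S) (z : S) : ℝ :=
  prefProb M (y ++ [z]) / prefProb M y

/-- Mean-centered logits `L_M[z ∣ y]`. -/
noncomputable def mcLogit {S : Type*} [Fintype S] [DecidableEq S] {T : ℕ}
    (M : (Fin T → S) → ℝ) (y : List S) (z : S) : ℝ :=
  Real.log (condProb M y z)
    - (1 / (Fintype.card S : ℝ)) * ∑ z', Real.log (condProb M y z')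

/-- Extended logit matrix `L_M(H, F)`: rows indexed by histories, columns by
(future, token) pairs, with entry `L_M[z ∣ h ∘ f]`. -/
noncomputable def logitMatrix {S : Type*} [Fintype S] [DecidableEq S] {T : ℕ}
    (M : (Fin T → S) → ℝ) {H F : Type*} (hist : H → List S) (fut : F → List S) :
    Matrix H (F × S) ℝ :=
  Matrix.of fun h p => mcLogit M (hist h ++ fut p.1) p.2


section LinearAlgebra

/-- A matrix whose rows are linear images of vectors in `ℝ^d` has rank at most `d`. -/
lemma Matrix.rank_le_of_row_eq_linearMap {m n : Type*} [Fintype n] {d : ℕ}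
    (L : Matrix m n ℝ) (x : m → Fin d → ℝ) (G : (Fin d → ℝ) →ₗ[ℝ] (n → ℝ))
    (h : ∀ i, L i = G (x i)) : L.rank ≤ d := by
  have hL : L = Matrix.of x * (LinearMap.toMatrix' G).transpose := by
    ext i j
    rw [h, ← LinearMap.toMatrix'_mulVec G (x i)]
    simp [Matrix.mul_apply, Matrix.mulVec, dotProduct, mul_comm]
  rw [hL]
  refine (Matrix.rank_mul_le_left _ _).trans ?_
  simpa using Matrix.rank_le_card_width (Matrix.of x)

/-- The rows of a matrix of rank at most `d` factor linearly through `ℝ^d`. -/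
lemma Matrix.exists_linearMap_of_rank_le {m n : Type*} [Finite m] [Fintype n] {d : ℕ}
    (L : Matrix m n ℝ) (h : L.rank ≤ d) :
    ∃ (φ : (n → ℝ) →ₗ[ℝ] (Fin d → ℝ)) (ψ : (Fin d → ℝ) →ₗ[ℝ] (n → ℝ)),
      ∀ i, ψ (φ (L i)) = L i := by
  classical
  rw [Matrix.rank_eq_finrank_span_row] at h
  set V := Submodule.span ℝ (Set.range L.row) with hV
  have hcard : Module.finrank ℝ V ≤ Module.finrank ℝ (Fin d → ℝ) := by simpa using h
  obtain ⟨f, hf⟩ := finrank_le_iff_exists_linearMap.1 hcard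
  obtain ⟨g, hg⟩ := f.exists_leftInverse_of_injective (LinearMap.ker_eq_bot.2 hf)
  obtain ⟨φ, hφ⟩ := f.exists_extend
  refine ⟨φ, V.subtype ∘ₗ g, fun i => ?_⟩
  have hi : L i ∈ V := Submodule.subset_span ⟨i, rfl⟩
  have h1 : φ (L i) = f ⟨L i, hi⟩ := LinearMap.congr_fun hφ ⟨L i, hi⟩
  have h2 : g (f ⟨L i, hi⟩) = ⟨L i, hi⟩ := LinearMap.congr_fun hg ⟨L i, hi⟩
  simp [h1, h2]

end LinearAlgebra

section LanguageModel

variable {S : Type*} [Fintype S] [DecidableEq S] {T : ℕ} (M : (Fin T → S) → ℝ)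

lemma prefProb_nil : prefProb M [] = ∑ z, M z := by
  simp [prefProb]

lemma prefProb_ofFn (z : Fin T → S) : prefProb M (List.ofFn z) = M z := by
  have : Finset.univ.filter
      (fun x : Fin T → S => (List.ofFn x).take (List.ofFn z).length = List.ofFn z) = {z} := by
    ext x
    simp [List.take_of_length_le, List.ofFn_inj]
  rw [prefProb, this, Finset.sum_singleton]

lemma prefProb_eq_zero {y : List S} (hy : T < y.length) : prefProb M y = 0 := by
  rw [prefProb, Finset.filter_false_of_mem, Finset.sum_empty]
  intro z _ h
  have := congrArg List.length h
  simp at this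
  omega

lemma prefProb_eq_sum_append {y : List S} (hy : y.length < T) :
    prefProb M y = ∑ s, prefProb M (y ++ [s]) := by
  simp only [prefProb, Finset.sum_filter]
  rw [Finset.sum_comm]
  refine Finset.sum_congr rfl fun z _ => ?_
  have hk : y.length < (List.ofFn z).length := by simpa using hy
  have key : ∀ s, ((List.ofFn z).take (y ++ [s]).length = y ++ [s]) ↔
      ((List.ofFn z)[y.length] = s ∧ (List.ofFn z).take y.length = y) := by
    intro s
    rw [List.length_append, List.length_singleton, List.take_succ_eq_append_getElem hk]
    constructor
    · intro h
      obtain ⟨h1, h2⟩ := List.append_inj' h rfl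
      exact ⟨by simpa using h2, h1⟩
    · rintro ⟨h1, h2⟩
      rw [h1, h2]
  simp only [key, ite_and, Finset.sum_ite_eq, Finset.mem_univ, if_true]

lemma List.exists_ofFn_eq {α : Type*} (y : List α) {n : ℕ} (h : y.length = n) :
    ∃ z : Fin n → α, List.ofFn z = y := by
  subst h
  exact ⟨y.get, List.ofFn_get y⟩

lemma prefProb_pos [Nonempty S] (hpos : ∀ z, 0 < M z) {y : List S} (hy : y.length ≤ T) :
    0 < prefProb M y := by
  induction k : T - y.length generalizing y with
  | zero =>
    obtain ⟨z, rfl⟩ := y.exists_ofFn_eq (n := T) (by omega)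
    rw [prefProb_ofFn]
    exact hpos z
  | succ k ih =>
    rw [prefProb_eq_sum_append M (by omega)]
    exact Finset.sum_pos (fun s _ => ih (by simp; omega) (by simp; omega))
      Finset.univ_nonempty

lemma condProb_pos [Nonempty S] (hpos : ∀ z, 0 < M z) {y : List S} (hy : y.length < T) (s : S) :
    0 < condProb M y s :=
  div_pos (prefProb_pos M hpos (by simp; omega)) (prefProb_pos M hpos hy.le)

lemma sum_condProb [Nonempty S] (hpos : ∀ z, 0 < M z) {y : List S} (hy : y.length < T) :
    ∑ s, condProb M y s = 1 := by
  simp only [condProb]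
  rw [← Finset.sum_div, ← prefProb_eq_sum_append M hy]
  exact div_self (prefProb_pos M hpos hy.le).ne'

lemma mcLogit_eq_zero {y : List S} (hy : T ≤ y.length) (s : S) : mcLogit M y s = 0 := by
  have : ∀ s, condProb M y s = 0 := fun s => by
    rw [condProb, prefProb_eq_zero M (by simp; omega), zero_div]
  simp [mcLogit, this]

lemma softmaxF_log_sub_const {S : Type*} [Fintype S] (p : S → ℝ) (hp : ∀ s, 0 < p s)
    (hsum : ∑ s, p s = 1) (c : ℝ) (s : S) :
    softmaxF (fun s => Real.log (p s) - c) s = p s := by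
  simp only [softmaxF, Real.exp_sub, Real.exp_log (hp _)]
  rw [← Finset.sum_div, hsum]
  field_simp

/-- The mean-centering of a vector, as a linear map. -/
noncomputable def meanCenter (S : Type*) [Fintype S] : (S → ℝ) →ₗ[ℝ] (S → ℝ) where
  toFun v s := v s - (1 / (Fintype.card S : ℝ)) * ∑ s', v s'
  map_add' v w := by
    ext s
    simp [Finset.sum_add_distrib]
    ring
  map_smul' c v := by
    ext s
    simp [← Finset.mul_sum]
    ring

lemma softmaxF_pos {S : Type*} [Fintype S] (v : S → ℝ) (s : S) : 0 < softmaxF v s :=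
  div_pos (Real.exp_pos _) (Finset.sum_pos (fun _ _ => Real.exp_pos _) ⟨s, Finset.mem_univ s⟩)

lemma sum_softmaxF {S : Type*} [Fintype S] [Nonempty S] (v : S → ℝ) : ∑ s, softmaxF v s = 1 := by
  simp only [softmaxF]
  rw [← Finset.sum_div]
  exact div_self (Finset.sum_pos (fun _ _ => Real.exp_pos _) Finset.univ_nonempty).ne'

lemma meanCenter_log_softmaxF {S : Type*} [Fintype S] [Nonempty S] (v : S → ℝ) :
    meanCenter S (fun s => Real.log (softmaxF v s)) = meanCenter S v := by
  have hZ : (∑ s, Real.exp (v s)) ≠ 0 :=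
    (Finset.sum_pos (fun _ _ => Real.exp_pos _) Finset.univ_nonempty).ne'
  have hc : (Fintype.card S : ℝ) ≠ 0 := by simp
  ext s
  simp only [meanCenter, LinearMap.coe_mk, AddHom.coe_mk, softmaxF,
    Real.log_div (Real.exp_pos _).ne' hZ, Real.log_exp, Finset.sum_sub_distrib,
    Finset.sum_const, Finset.card_univ, nsmul_eq_mul]
  field_simp
  ring

lemma mcLogit_eq_meanCenter (y : List S) :
    mcLogit M y = meanCenter S (fun s => Real.log (condProb M y s)) := rfl

/-- The chain rule for the probability of a prefix. -/
lemma prefProb_ofFn_eq_prod_condProb [Nonempty S] (hpos : ∀ z, 0 < M z) (hsum : ∑ z, M z = 1)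
    (w : ℕ → S) {k : ℕ} (hk : k ≤ T) :
    prefProb M (List.ofFn fun i : Fin k => w i) =
      ∏ t ∈ Finset.range k, condProb M (List.ofFn fun i : Fin t => w i) (w t) := by
  induction k with
  | zero => simp [prefProb_nil, hsum]
  | succ k ih =>
    have hne := (prefProb_pos M hpos (y := List.ofFn fun i : Fin k => w i)
      (by simp; omega)).ne'
    rw [Finset.prod_range_succ, ← ih (by omega), condProb, mul_div_cancel₀ _ hne,
      List.ofFn_succ', List.concat_eq_append]
    rfl

end LanguageModel

section ISAN

variable {S : Type*} {d : ℕ}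

lemma tvState_congr (A : S → ℕ → Matrix (Fin d) (Fin d) ℝ) (x0 : Fin d → ℝ) {w w' : ℕ → S}
    {t : ℕ} (h : ∀ i < t, w i = w' i) : tvState A x0 w t = tvState A x0 w' t := by
  induction t with
  | zero => rfl
  | succ t ih =>
    rw [tvState, tvState, ih fun i hi => h i (by omega), h t (by omega)]

lemma tvState_add (A : S → ℕ → Matrix (Fin d) (Fin d) ℝ) (x0 : Fin d → ℝ) (w : ℕ → S)
    (t j : ℕ) : tvState A x0 w (t + j) =
      tvState (fun s i => A s (t + i)) (tvState A x0 w t) (fun i => w (t + i)) j := by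
  induction j with
  | zero => rfl
  | succ j ih => rw [← add_assoc, tvState, tvState, ih]

/-- The hidden state of a time-varying ISAN as a linear function of the initial state. -/
noncomputable def tvStateLin (A : S → ℕ → Matrix (Fin d) (Fin d) ℝ) (w : ℕ → S) :
    ℕ → (Fin d → ℝ) →ₗ[ℝ] (Fin d → ℝ)
  | 0 => LinearMap.id
  | t + 1 => (A (w t) t).mulVecLin ∘ₗ tvStateLin A w t

lemma tvStateLin_apply (A : S → ℕ → Matrix (Fin d) (Fin d) ℝ) (x0 : Fin d → ℝ) (w : ℕ → S)
    (t : ℕ) : tvStateLin A w t x0 = tvState A x0 w t := by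
  induction t with
  | zero => rfl
  | succ t ih => simp [tvStateLin, tvState, ih]

/-- Extend a list to an infinite word. -/
noncomputable def List.toWord [Nonempty S] (y : List S) (i : ℕ) : S :=
  y.getD i (Classical.arbitrary S)

lemma List.toWord_append_left [Nonempty S] (y f : List S) {i : ℕ} (hi : i < y.length) :
    (y ++ f).toWord i = y.toWord i :=
  List.getD_append _ _ _ _ hi

lemma List.toWord_append_right [Nonempty S] (y f : List S) (i : ℕ) :
    (y ++ f).toWord (y.length + i) = f.toWord i := by
  rw [List.toWord, List.getD_append_right _ _ _ _ (by omega), Nat.add_sub_cancel_left,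
    List.toWord]

lemma tvProb_congr [Fintype S] (A : S → ℕ → Matrix (Fin d) (Fin d) ℝ)
    (B : ℕ → Matrix S (Fin d) ℝ) (x0 : Fin d → ℝ) {w w' : ℕ → S} {k : ℕ}
    (h : ∀ i < k, w i = w' i) : tvProb k A B x0 w = tvProb k A B x0 w' := by
  refine Finset.prod_congr rfl fun t ht => ?_
  rw [Finset.mem_range] at ht
  rw [h t ht, tvState_congr A x0 fun i hi => h i (by omega)]

variable [Fintype S]

lemma tvProb_append_singleton [Nonempty S] (A : S → ℕ → Matrix (Fin d) (Fin d) ℝ)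
    (B : ℕ → Matrix S (Fin d) ℝ) (x0 : Fin d → ℝ) (y : List S) (s : S) :
    tvProb (y.length + 1) A B x0 (y ++ [s]).toWord = tvProb y.length A B x0 y.toWord *
      softmaxF ((B y.length).mulVec (tvState A x0 y.toWord y.length)) s := by
  have h : ∀ i < y.length, (y ++ [s]).toWord i = y.toWord i :=
    fun i hi => y.toWord_append_left _ hi
  have hs : (y ++ [s]).toWord y.length = s := y.toWord_append_right [s] 0
  rw [tvProb, Finset.prod_range_succ, ← tvProb, tvProb_congr A B x0 h, tvState_congr A x0 h, hs]

variable [DecidableEq S] {T : ℕ}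

lemma prefProb_eq_tvProb [Nonempty S] {M : (Fin T → S) → ℝ} {A : S → ℕ → Matrix (Fin d) (Fin d) ℝ}
    {B : ℕ → Matrix S (Fin d) ℝ} {x0 : Fin d → ℝ}
    (hM : ∀ z : Fin T → S, M z = tvProb T A B x0 (extSeq z)) {y : List S} (hy : y.length ≤ T) :
    prefProb M y = tvProb y.length A B x0 y.toWord := by
  induction k : T - y.length generalizing y with
  | zero =>
    obtain ⟨z, rfl⟩ := y.exists_ofFn_eq (n := T) (by omega)
    rw [prefProb_ofFn, hM, List.length_ofFn]
    refine tvProb_congr A B x0 fun i hi => ?_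
    simp [extSeq, List.toWord, hi]
  | succ k ih =>
    rw [prefProb_eq_sum_append M (by omega)]
    have : ∀ s, prefProb M (y ++ [s]) = tvProb y.length A B x0 y.toWord *
        softmaxF ((B y.length).mulVec (tvState A x0 y.toWord y.length)) s := fun s => by
      rw [ih (by simp; omega) (by simp; omega), ← tvProb_append_singleton]
      simp
    simp only [this]
    rw [← Finset.mul_sum, sum_softmaxF, mul_one]

lemma mcLogit_eq_meanCenter_tvState [Nonempty S] {M : (Fin T → S) → ℝ}
    {A : S → ℕ → Matrix (Fin d) (Fin d) ℝ}
    {B : ℕ → Matrix S (Fin d) ℝ} {x0 : Fin d → ℝ}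
    (hM : ∀ z : Fin T → S, M z = tvProb T A B x0 (extSeq z)) {y : List S} (hy : y.length < T) :
    mcLogit M y =
      meanCenter S ((B y.length).mulVec (tvState A x0 y.toWord y.length)) := by
  rw [mcLogit_eq_meanCenter, ← meanCenter_log_softmaxF ((B y.length).mulVec _)]
  refine congrArg _ (funext fun s => congrArg _ ?_)
  have hne : tvProb y.length A B x0 y.toWord ≠ 0 :=
    (Finset.prod_pos fun _ _ => softmaxF_pos _ _).ne'
  rw [condProb, prefProb_eq_tvProb hM hy.le, prefProb_eq_tvProb hM (by simp; omega)]
  rw [List.length_append, List.length_singleton, tvProb_append_singleton,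
    mul_div_cancel_left₀ _ hne]

lemma rank_logitMatrix_le_of_tvProb [Nonempty S] {M : (Fin T → S) → ℝ}
    {A : S → ℕ → Matrix (Fin d) (Fin d) ℝ} {B : ℕ → Matrix S (Fin d) ℝ} {x0 : Fin d → ℝ}
    (hM : ∀ z : Fin T → S, M z = tvProb T A B x0 (extSeq z)) (t : ℕ)
    {F : Type*} [Fintype F] (fut : F → List S) :
    (logitMatrix M (fun h : Fin t → S => List.ofFn h) fut).rank ≤ d := by
  refine Matrix.rank_le_of_row_eq_linearMap _
    (fun h => tvState A x0 (List.ofFn h).toWord t)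
    (LinearMap.pi fun p : F × S =>
      if t + (fut p.1).length < T then
        LinearMap.proj p.2 ∘ₗ meanCenter S ∘ₗ (B (t + (fut p.1).length)).mulVecLin ∘ₗ
          tvStateLin (fun s i => A s (t + i)) (fut p.1).toWord (fut p.1).length
      else 0) fun h => ?_
  ext p
  rw [LinearMap.pi_apply, logitMatrix, Matrix.of_apply]
  have hlen : (List.ofFn h ++ fut p.1).length = t + (fut p.1).length := by simp
  split_ifs with hp
  · rw [mcLogit_eq_meanCenter_tvState hM (by omega), hlen, tvState_add]
    have h1 : tvState A x0 (List.ofFn h ++ fut p.1).toWord t =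
        tvState A x0 (List.ofFn h).toWord t :=
      tvState_congr A x0 fun i hi => List.toWord_append_left _ _ (by simpa using hi)
    have h2 : (fun i => (List.ofFn h ++ fut p.1).toWord (t + i)) = (fut p.1).toWord := by
      ext i
      simpa using (List.ofFn h).toWord_append_right (fut p.1) i
    rw [h1, h2]
    simp [tvStateLin_apply]
  · rw [mcLogit_eq_zero M (by omega)]
    rfl

/-- The futures of length at most `T - t`. -/
abbrev Future (S : Type*) (T t : ℕ) : Type _ := (j : Fin (T - t + 1)) × (Fin (j : ℕ) → S)

/-- The extended logit matrix with histories of length `t` and futures of length at most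
`T - t`. -/
noncomputable abbrev fullLogitMatrix (M : (Fin T → S) → ℝ) (t : ℕ) :
    Matrix (Fin t → S) (Future S T t × S) ℝ :=
  logitMatrix M (fun h : Fin t → S => List.ofFn h) (fun f : Future S T t => List.ofFn f.2)

/-- Appending a token to the history restricts a row of the extended logit matrix. -/
lemma exists_linearMap_fullLogitMatrix_succ (M : (Fin T → S) → ℝ) {t : ℕ} (ht : t < T) (s : S) :
    ∃ R : (Future S T t × S → ℝ) →ₗ[ℝ] (Future S T (t + 1) × S → ℝ),
      ∀ w : ℕ → S, w t = s →
        R (fullLogitMatrix M t fun i => w i) = fullLogitMatrix M (t + 1) fun i => w i := by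
  refine ⟨LinearMap.funLeft ℝ ℝ fun p =>
    (⟨⟨p.1.1 + 1, by have := p.1.1.2; omega⟩, Fin.cons s p.1.2⟩, p.2), fun w hw => ?_⟩
  ext p
  simp only [LinearMap.funLeft_apply, fullLogitMatrix, logitMatrix, Matrix.of_apply]
  congr 1
  rw [List.ofFn_succ' (fun i : Fin (t + 1) => w i), List.ofFn_cons, List.concat_eq_append,
    List.append_assoc, List.singleton_append, Fin.val_last, hw]
  rfl

lemma exists_tvProb_of_rank_le [Nonempty S] {M : (Fin T → S) → ℝ} (hpos : ∀ z, 0 < M z)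
    (hsum : ∑ z, M z = 1) (hrank : ∀ t < T, (fullLogitMatrix M t).rank ≤ d) :
    ∃ (A : S → ℕ → Matrix (Fin d) (Fin d) ℝ) (B : ℕ → Matrix S (Fin d) ℝ)
      (x0 : Fin d → ℝ), ∀ z : Fin T → S, M z = tvProb T A B x0 (extSeq z) := by
  have hfactor : ∀ t, ∃ (φ : (Future S T t × S → ℝ) →ₗ[ℝ] (Fin d → ℝ))
      (ψ : (Fin d → ℝ) →ₗ[ℝ] (Future S T t × S → ℝ)), t < T →
        ∀ h, ψ (φ (fullLogitMatrix M t h)) = fullLogitMatrix M t h := fun t => by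
    by_cases ht : t < T
    · obtain ⟨φ, ψ, h⟩ := Matrix.exists_linearMap_of_rank_le _ (hrank t ht)
      exact ⟨φ, ψ, fun _ => h⟩
    · exact ⟨0, 0, fun h => absurd h ht⟩
  have hrestrict : ∀ t s, ∃ R : (Future S T t × S → ℝ) →ₗ[ℝ] (Future S T (t + 1) × S → ℝ),
      t < T → ∀ w : ℕ → S, w t = s →
        R (fullLogitMatrix M t fun i => w i) = fullLogitMatrix M (t + 1) fun i => w i :=
    fun t s => by
      by_cases ht : t < T
      · obtain ⟨R, h⟩ := exists_linearMap_fullLogitMatrix_succ M ht s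
        exact ⟨R, fun _ => h⟩
      · exact ⟨0, fun h => absurd h ht⟩
  choose φ ψ hψ using hfactor
  choose R hR using hrestrict
  let out (t : ℕ) : (Future S T t × S → ℝ) →ₗ[ℝ] (S → ℝ) :=
    LinearMap.funLeft ℝ ℝ fun s => (⟨0, Fin.elim0⟩, s)
  let A (s : S) (t : ℕ) : Matrix (Fin d) (Fin d) ℝ :=
    LinearMap.toMatrix' (φ (t + 1) ∘ₗ R t s ∘ₗ ψ t)
  let B (t : ℕ) : Matrix S (Fin d) ℝ := LinearMap.toMatrix' (out t ∘ₗ ψ t)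
  let x0 : Fin d → ℝ := φ 0 (fullLogitMatrix M 0 Fin.elim0)
  have hstate : ∀ (w : ℕ → S) (t : ℕ), t < T →
      tvState A x0 w t = φ t (fullLogitMatrix M t fun i => w i) := by
    intro w t
    induction t with
    | zero =>
      intro _
      rw [tvState, Subsingleton.elim (fun i : Fin 0 => w i) Fin.elim0]
    | succ t ih =>
      intro ht
      have ht' : t < T := by omega
      rw [tvState, ih ht', LinearMap.toMatrix'_mulVec, LinearMap.comp_apply,
        LinearMap.comp_apply, hψ t ht', hR t (w t) ht' w rfl]
  refine ⟨A, B, x0, fun z => ?_⟩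
  have hz : (List.ofFn fun i : Fin T => extSeq z i) = List.ofFn z := by
    congr 1
    ext i
    simp [extSeq]
  rw [← prefProb_ofFn M z, ← hz, prefProb_ofFn_eq_prod_condProb M hpos hsum _ le_rfl, tvProb]
  refine Finset.prod_congr rfl fun t ht => ?_
  rw [Finset.mem_range] at ht
  have hlogit : (B t).mulVec (tvState A x0 (extSeq z) t) =
      mcLogit M (List.ofFn fun i : Fin t => extSeq z i) := by
    rw [hstate _ t ht, LinearMap.toMatrix'_mulVec, LinearMap.comp_apply, hψ t ht]
    ext s
    simp [out, LinearMap.funLeft_apply, logitMatrix]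
  rw [hlogit]
  have hlen : (List.ofFn fun i : Fin t => extSeq z i).length < T := by simpa using ht
  exact (softmaxF_log_sub_const _ (condProb_pos M hpos hlen) (sum_condProb M hpos hlen) _ _).symm

end ISAN

/-- equivalence of low logit rank and time-varying ISANs: a language model
`M` on `Σ^T` with full support is expressible as a time-varying ISAN with hidden
dimension `d` if and only if the extended logit matrix `L_M(Σ^t, Σ^{≤T−t})` has rank at
most `d` for all `t ∈ {0, …, T−1}`. -/
theorem stmt_9 {S : Type*} [Fintype S] [DecidableEq S] [Nonempty S] (T d : ℕ)
    (M : (Fin T → S) → ℝ) (hpos : ∀ z, 0 < M z) (hsum : ∑ z, M z = 1) :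
    (∃ (A : S → ℕ → Matrix (Fin d) (Fin d) ℝ) (B : ℕ → Matrix S (Fin d) ℝ)
        (x0 : Fin d → ℝ), ∀ z : Fin T → S, M z = tvProb T A B x0 (extSeq z))
      ↔ (∀ t : ℕ, t < T →
          (logitMatrix M (fun h : Fin t → S => List.ofFn h)
            (fun f : (j : Fin (T - t + 1)) × (Fin (j : ℕ) → S) => List.ofFn f.2)).rank
            ≤ d) := by
  constructor
  · rintro ⟨A, B, x0, hM⟩ t _
    exact rank_logitMatrix_le_of_tvProb hM t _
  · exact exists_tvProb_of_rank_le hpos hsum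
end

section
/- Under the same hypotheses as the LinGen generalization lemma (the matrix-coverage condition with parameters α, γ, and regression error E_{f∼P_1}[‖L_M({h_0},{f}) − vᵀ L_M(H,{f})‖²] ≤ Δ), assume additionally that |L_M[z|h]| ≤ C for every history h ∈ Σ* and token z ∈ Σ. Then KL(P_LinGen ‖ P_truth) ≤ 2·(1 + k·(log|Σ| + 2C))·sqrt(k)·(α·Δ + γ·(1 + ‖v‖²))^{1/4}. -/
open Matrix

/-- Mean-centered next-token logits `L_M[z ∣ y]` of a language model `M` which assigns
to every history `y ∈ Σ*` a next-token distribution `M y`. -/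
noncomputable def nextLogit {S : Type*} [Fintype S] (M : List S → S → ℝ)
    (y : List S) (z : S) : ℝ :=
  Real.log (M y z) - (1 / (Fintype.card S : ℝ)) * ∑ z', Real.log (M y z')

/-- The `|H| × |Σ|` logit matrix `L_M(H, {f})` for a family of histories `hs` and a
single future `f`. -/
noncomputable def logitMat {S : Type*} [Fintype S] {ι : Type*} (M : List S → S → ℝ)
    (hs : ι → List S) (f : List S) : Matrix ι S ℝ :=
  Matrix.of fun i z => nextLogit M (hs i ++ f) z

/-- The second-moment matrix `L_M(H,{f}) L_M(H,{f})ᵀ`. -/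
noncomputable def sqMoment {S : Type*} [Fintype S] {ι : Type*} (M : List S → S → ℝ)
    (hs : ι → List S) (f : List S) : Matrix ι ι ℝ :=
  logitMat M hs f * (logitMat M hs f)ᵀ

/-- Probability under `M` of generating the continuation `f` after the history `h`. -/
noncomputable def contProb {S : Type*} (M : List S → S → ℝ) (h : List S) {t : ℕ}
    (f : Fin t → S) : ℝ :=
  ∏ i : Fin t, M (h ++ (List.ofFn f).take (i : ℕ)) (f i)

/-- `E_{f ∼ P₁}[L_M(H,{f}) L_M(H,{f})ᵀ]` where `P₁` draws `t` uniformly from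
`{0, …, k−1}` and then a uniformly random future in `Σ^t`. -/
noncomputable def unifMoment {S : Type*} [Fintype S] {ι : Type*} (M : List S → S → ℝ)
    (hs : ι → List S) (k : ℕ) : Matrix ι ι ℝ :=
  Matrix.of fun a b => (1 / (k : ℝ)) * ∑ t ∈ Finset.range k,
    ((1 : ℝ) / (Fintype.card S : ℝ) ^ t) * ∑ f : Fin t → S,
      sqMoment M hs (List.ofFn f) a b

/-- `E_{f ∼ P₂}[L_M(H,{f}) L_M(H,{f})ᵀ]` where `P₂` draws `t` uniformly from
`{0, …, k−1}` and then a length-`t` continuation of `h0` according to `M`. -/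
noncomputable def modelMoment {S : Type*} [Fintype S] {ι : Type*} (M : List S → S → ℝ)
    (hs : ι → List S) (h0 : List S) (k : ℕ) : Matrix ι ι ℝ :=
  Matrix.of fun a b => (1 / (k : ℝ)) * ∑ t ∈ Finset.range k,
    ∑ f : Fin t → S, contProb M h0 f * sqMoment M hs (List.ofFn f) a b

/-- The distribution of length-`k` continuations of `h0` under `M`. -/
noncomputable def truthProb {S : Type*} (M : List S → S → ℝ) (h0 : List S) (k : ℕ)
    (w : Fin k → S) : ℝ :=
  ∏ t : Fin k, M (h0 ++ (List.ofFn w).take (t : ℕ)) (w t)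

/-- The distribution of `LinGen(v, H, k)`: the token `z_t` is sampled from
`softmax (Σ_h v_h · L_M[· ∣ h ∘ z_{1:t−1}])`. -/
noncomputable def lingenProb {S : Type*} [Fintype S] {n : ℕ} (M : List S → S → ℝ)
    (hs : Fin n → List S) (v : Fin n → ℝ) (k : ℕ) (w : Fin k → S) : ℝ :=
  ∏ t : Fin k,
    softmaxF (fun z => ∑ i, v i * nextLogit M (hs i ++ (List.ofFn w).take (t : ℕ)) z)
      (w t)

/-- KL divergence between two distributions on `Σ^k`. -/
noncomputable def klSeq {S : Type*} [Fintype S] (k : ℕ) (P Q : (Fin k → S) → ℝ) : ℝ :=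
  ∑ w : Fin k → S, P w * Real.log (P w / Q w)


/-- The probability of a length-`k` sequence generated autoregressively by the next-token
kernel `p`. -/
def seqProb {S : Type*} (p : List S → S → ℝ) {k : ℕ} (w : Fin k → S) : ℝ :=
  ∏ t : Fin k, p ((List.ofFn w).take (t : ℕ)) (w t)

section Sequences

variable {S : Type*}

lemma seqProb_pos {p : List S → S → ℝ} (hp : ∀ y z, 0 < p y z) {k : ℕ} (w : Fin k → S) :
    0 < seqProb p w :=
  Finset.prod_pos fun _ _ => hp _ _

lemma take_ofFn_snoc {k : ℕ} (w : Fin k → S) (z : S) {t : ℕ} (ht : t ≤ k) :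
    (List.ofFn (Fin.snoc w z : Fin (k + 1) → S)).take t = (List.ofFn w).take t := by
  have h : List.ofFn (Fin.snoc w z : Fin (k + 1) → S) = List.ofFn w ++ [z] := by
    rw [List.ofFn_succ']
    simp
  rw [h, List.take_append_of_le_length (by simpa using ht)]

lemma seqProb_snoc (p : List S → S → ℝ) {k : ℕ} (w : Fin k → S) (z : S) :
    seqProb p (Fin.snoc w z : Fin (k + 1) → S) = seqProb p w * p (List.ofFn w) z := by
  unfold seqProb
  rw [Fin.prod_univ_castSucc]
  congr 1
  · refine Finset.prod_congr rfl fun t _ => ?_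
    rw [Fin.snoc_castSucc, Fin.val_castSucc, take_ofFn_snoc w z t.is_lt.le]
  · rw [Fin.snoc_last, Fin.val_last, take_ofFn_snoc w z le_rfl,
      List.take_of_length_le (by simp)]

variable [Fintype S]

lemma sum_snoc {k : ℕ} (F : (Fin (k + 1) → S) → ℝ) :
    ∑ w, F w = ∑ w : Fin k → S, ∑ z, F (Fin.snoc w z) := by
  rw [← Equiv.sum_comp (Fin.snocEquiv fun _ => S) F, Fintype.sum_prod_type_right]
  rfl

lemma sum_seqProb {p : List S → S → ℝ} (hp : ∀ y, ∑ z, p y z = 1) (k : ℕ) :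
    ∑ w : Fin k → S, seqProb p w = 1 := by
  induction k with
  | zero => simp [seqProb]
  | succ k ih => simp_rw [sum_snoc, seqProb_snoc, ← Finset.mul_sum, hp, mul_one, ih]

/-- The chain rule for the KL divergence between two autoregressive distributions. -/
lemma klSeq_seqProb {p q : List S → S → ℝ} (hp : ∀ y z, 0 < p y z) (hq : ∀ y z, 0 < q y z)
    (hp1 : ∀ y, ∑ z, p y z = 1) (k : ℕ) :
    klSeq k (seqProb p) (seqProb q) = ∑ t ∈ Finset.range k, ∑ w : Fin t → S,
      seqProb p w * ∑ z, p (List.ofFn w) z * Real.log (p (List.ofFn w) z / q (List.ofFn w) z) := by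
  induction k with
  | zero => simp [klSeq, seqProb]
  | succ k ih =>
    rw [Finset.sum_range_succ, ← ih]
    unfold klSeq
    rw [sum_snoc, ← Finset.sum_add_distrib]
    refine Finset.sum_congr rfl fun w _ => ?_
    have h : ∀ z, seqProb p (Fin.snoc w z : Fin (k + 1) → S) *
        Real.log (seqProb p (Fin.snoc w z : Fin (k + 1) → S) /
          seqProb q (Fin.snoc w z : Fin (k + 1) → S)) =
        p (List.ofFn w) z * (seqProb p w * Real.log (seqProb p w / seqProb q w)) +
        seqProb p w * (p (List.ofFn w) z *
          Real.log (p (List.ofFn w) z / q (List.ofFn w) z)) := fun z => by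
      rw [seqProb_snoc, seqProb_snoc, mul_div_mul_comm,
        Real.log_mul (div_pos (seqProb_pos hp w) (seqProb_pos hq w)).ne'
          (div_pos (hp _ _) (hq _ _)).ne']
      ring
    simp_rw [h]
    rw [Finset.sum_add_distrib, ← Finset.sum_mul, hp1, one_mul, Finset.mul_sum]

end Sequences

section FiniteDistributions

variable {ι : Type*} [Fintype ι] {P Q : ι → ℝ}

/-- A weak form of Pinsker's inequality, through the Hellinger distance. -/
lemma sum_abs_sub_sq_le (hP : ∀ i, 0 < P i) (hQ : ∀ i, 0 < Q i) (hP1 : ∑ i, P i = 1)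
    (hQ1 : ∑ i, Q i = 1) :
    (∑ i, |P i - Q i|) ^ 2 ≤ 4 * ∑ i, P i * Real.log (P i / Q i) := by
  have hcs := Finset.sum_mul_sq_le_sq_mul_sq Finset.univ
    (fun i => |√(P i) - √(Q i)|) (fun i => √(P i) + √(Q i))
  have hprod : ∀ i, |√(P i) - √(Q i)| * (√(P i) + √(Q i)) = |P i - Q i| := fun i => by
    rw [← abs_of_nonneg (add_nonneg (Real.sqrt_nonneg (P i)) (Real.sqrt_nonneg (Q i))),
      ← abs_mul]
    congr 1
    linarith [Real.mul_self_sqrt (hP i).le, Real.mul_self_sqrt (hQ i).le]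
  simp_rw [hprod, sq_abs] at hcs
  have hadd : ∑ i, (√(P i) + √(Q i)) ^ 2 ≤ 4 := by
    calc ∑ i, (√(P i) + √(Q i)) ^ 2 ≤ ∑ i, (2 * P i + 2 * Q i) := by
          refine Finset.sum_le_sum fun i _ => ?_
          nlinarith [Real.sq_sqrt (hP i).le, Real.sq_sqrt (hQ i).le, sq_nonneg (√(P i) - √(Q i))]
      _ = 4 := by
        rw [Finset.sum_add_distrib, ← Finset.mul_sum, ← Finset.mul_sum, hP1, hQ1]
        norm_num
  have hsub : ∑ i, (√(P i) - √(Q i)) ^ 2 ≤ ∑ i, P i * Real.log (P i / Q i) := by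
    calc ∑ i, (√(P i) - √(Q i)) ^ 2 ≤ ∑ i, (P i * Real.log (P i / Q i) + (Q i - P i)) := by
          refine Finset.sum_le_sum fun i _ => ?_
          have hx := Real.sqrt_pos.2 (hP i)
          have hy := Real.sqrt_pos.2 (hQ i)
          have hlog := Real.log_le_sub_one_of_pos (div_pos hy hx)
          have heq : Real.log (P i / Q i) = -(2 * Real.log (√(Q i) / √(P i))) := by
            rw [Real.log_div (hP i).ne' (hQ i).ne', Real.log_div hy.ne' hx.ne',
              Real.log_sqrt (hP i).le, Real.log_sqrt (hQ i).le]
            ring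
          have hmul : P i * (√(Q i) / √(P i)) = √(P i) * √(Q i) := by
            nth_rewrite 1 [← Real.mul_self_sqrt (hP i).le]
            field_simp
          rw [heq]
          nlinarith [mul_le_mul_of_nonneg_left hlog (hP i).le, Real.sq_sqrt (hP i).le,
            Real.sq_sqrt (hQ i).le]
      _ = _ := by rw [Finset.sum_add_distrib, Finset.sum_sub_distrib, hP1, hQ1]; ring
  have hnn : 0 ≤ ∑ i, (√(P i) - √(Q i)) ^ 2 := Finset.sum_nonneg fun i _ => sq_nonneg _
  nlinarith

/-- If the log-likelihood ratio is at most `B`, then the KL divergence is at most `1 + B`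
times the total variation distance. -/
lemma sum_mul_log_div_le {B : ℝ} (hP : ∀ i, 0 < P i) (hQ : ∀ i, 0 < Q i)
    (hPQ : ∑ i, P i = ∑ i, Q i) (hB : ∀ i, Real.log (P i / Q i) ≤ B) :
    ∑ i, P i * Real.log (P i / Q i) ≤ (1 + B) * ((∑ i, |P i - Q i|) / 2) := by
  calc ∑ i, P i * Real.log (P i / Q i)
      ≤ ∑ i, (1 + B) * ((|P i - Q i| + (P i - Q i)) / 2) := by
        refine Finset.sum_le_sum fun i _ => ?_
        rcases le_total (P i) (Q i) with h | h
        · rw [abs_of_nonpos (sub_nonpos.2 h)]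
          have := Real.log_nonpos (div_pos (hP i) (hQ i)).le ((div_le_one (hQ i)).2 h)
          nlinarith [hP i]
        · rw [abs_of_nonneg (sub_nonneg.2 h)]
          have h1 := mul_le_mul_of_nonneg_left
            (Real.log_le_sub_one_of_pos (div_pos (hP i) (hQ i))) (hQ i).le
          have h2 := mul_le_mul_of_nonneg_left (hB i) (sub_nonneg.2 h)
          have h3 : Q i * (P i / Q i - 1) = P i - Q i := by
            have := (hQ i).ne'
            field_simp
          nlinarith
    _ = _ := by
        rw [← Finset.mul_sum, ← Finset.sum_div, Finset.sum_add_distrib,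
          Finset.sum_sub_distrib, hPQ, sub_self, add_zero]

end FiniteDistributions

section Softmax

variable {S : Type*} [Fintype S]

lemma sum_exp_pos [Nonempty S] (a : S → ℝ) : 0 < ∑ z, Real.exp (a z) :=
  Finset.sum_pos (fun _ _ => Real.exp_pos _) Finset.univ_nonempty

lemma softmaxF_pos_s15 [Nonempty S] (a : S → ℝ) (z : S) : 0 < softmaxF a z :=
  div_pos (Real.exp_pos _) (sum_exp_pos a)

lemma sum_softmaxF_s15 [Nonempty S] (a : S → ℝ) : ∑ z, softmaxF a z = 1 := by
  unfold softmaxF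
  rw [← Finset.sum_div, div_self (sum_exp_pos a).ne']

lemma softmaxF_nextLogit {M : List S → S → ℝ} (hfull : ∀ y z, 0 < M y z)
    (hsum : ∀ y, ∑ z, M y z = 1) (y : List S) : softmaxF (nextLogit M y) = M y := by
  funext z
  simp only [softmaxF, nextLogit, Real.exp_sub, Real.exp_log (hfull y _)]
  rw [← Finset.sum_div, hsum, div_div_div_cancel_right₀ (Real.exp_pos _).ne', div_one]

lemma neg_log_softmaxF_le [Nonempty S] {a : S → ℝ} {C : ℝ} (ha : ∀ z, |a z| ≤ C) (z : S) :
    -Real.log (softmaxF a z) ≤ Real.log (Fintype.card S) + 2 * C := by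
  have hle : ∑ z', Real.exp (a z') ≤ Fintype.card S * Real.exp C := by
    calc ∑ z', Real.exp (a z') ≤ ∑ _z' : S, Real.exp C :=
          Finset.sum_le_sum fun z' _ => Real.exp_le_exp.2 (abs_le.1 (ha z')).2
      _ = _ := by simp
  have hlog := Real.log_le_log (sum_exp_pos a) hle
  rw [Real.log_mul (by simp) (Real.exp_pos _).ne', Real.log_exp] at hlog
  rw [softmaxF, Real.log_div (Real.exp_pos _).ne' (sum_exp_pos a).ne', Real.log_exp]
  linarith [(abs_le.1 (ha z)).1]

/-- The KL divergence between two softmax distributions is at most twice the squared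
distance of their logits. -/
lemma sum_softmaxF_mul_log_div_le [Nonempty S] (a b : S → ℝ) :
    ∑ z, softmaxF a z * Real.log (softmaxF a z / softmaxF b z) ≤
      2 * ∑ z, (a z - b z) ^ 2 := by
  set p := softmaxF a with hp
  have hp0 : ∀ z, 0 < p z := softmaxF_pos_s15 a
  have hp1 : ∑ z, p z = 1 := sum_softmaxF_s15 a
  set R := ∑ z, (a z - b z) ^ 2
  have hd : ∀ z, (a z - b z) ^ 2 ≤ R := fun z =>
    Finset.single_le_sum (f := fun z => (a z - b z) ^ 2) (fun _ _ => sq_nonneg _)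
      (Finset.mem_univ z)
  have hR0 : 0 ≤ R := Finset.sum_nonneg fun _ _ => sq_nonneg _
  have habs : ∀ z, |a z - b z| ≤ √R := fun z => Real.abs_le_sqrt (hd z)
  set Z := ∑ z, p z * Real.exp (b z - a z) with hZ
  have hZeq : Z = (∑ z, Real.exp (b z)) / ∑ z, Real.exp (a z) := by
    rw [hZ, Finset.sum_div]
    refine Finset.sum_congr rfl fun z _ => ?_
    rw [hp, softmaxF, Real.exp_sub]
    have := (Real.exp_pos (a z)).ne'
    field_simp
  have hZ0 : 0 < Z := hZeq ▸ div_pos (sum_exp_pos b) (sum_exp_pos a)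
  have hkl : ∑ z, p z * Real.log (p z / softmaxF b z) =
      Real.log Z + ∑ z, p z * (a z - b z) := by
    have hlog : ∀ z, Real.log (p z / softmaxF b z) = Real.log Z + (a z - b z) := fun z => by
      rw [Real.log_div (hp0 z).ne' (softmaxF_pos_s15 b z).ne', hZeq, hp, softmaxF, softmaxF,
        Real.log_div (Real.exp_pos _).ne' (sum_exp_pos a).ne',
        Real.log_div (Real.exp_pos _).ne' (sum_exp_pos b).ne',
        Real.log_div (sum_exp_pos b).ne' (sum_exp_pos a).ne', Real.log_exp, Real.log_exp]
      ring
    simp_rw [hlog, mul_add]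
    rw [Finset.sum_add_distrib, ← Finset.sum_mul, hp1, one_mul]
  have havg : ∀ (g : S → ℝ) (c : ℝ), (∀ z, g z ≤ c) → ∑ z, p z * g z ≤ c := fun g c hg => by
    calc ∑ z, p z * g z ≤ ∑ z, p z * c :=
          Finset.sum_le_sum fun z _ => mul_le_mul_of_nonneg_left (hg z) (hp0 z).le
      _ = c := by rw [← Finset.sum_mul, hp1, one_mul]
  rw [hkl]
  rcases le_total R 1 with hR1 | hR1
  · have hexp : ∀ z, Real.exp (b z - a z) - 1 + (a z - b z) ≤ R := fun z => by
      have h1 : |b z - a z| ≤ 1 := by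
        rw [abs_sub_comm]
        exact (habs z).trans (Real.sqrt_le_one.2 hR1)
      have := (abs_le.1 (Real.abs_exp_sub_one_sub_id_le h1)).2
      nlinarith [hd z]
    have h := havg _ _ hexp
    have hsplit : ∑ z, p z * (Real.exp (b z - a z) - 1 + (a z - b z)) =
        Z - 1 + ∑ z, p z * (a z - b z) := by
      simp_rw [mul_add, mul_sub, mul_one]
      rw [Finset.sum_add_distrib, Finset.sum_sub_distrib, hp1]
    linarith [Real.log_le_sub_one_of_pos hZ0]
  · have hsq : √R ≤ R := by
      rw [Real.sqrt_le_left hR0]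
      nlinarith
    have h1 : Z ≤ Real.exp √R := havg _ _ fun z => Real.exp_le_exp.2 <| by
      linarith [(abs_le.1 (habs z)).1]
    have h2 := Real.log_le_log hZ0 h1
    rw [Real.log_exp] at h2
    linarith [havg _ _ fun z => (abs_le.1 (habs z)).2]

end Softmax

section Moments

variable {S : Type*} [Fintype S] {ι : Type*} [Fintype ι]

lemma dotProduct_sqMoment_mulVec (M : List S → S → ℝ) (hs : ι → List S) (f : List S)
    (u : ι → ℝ) :
    u ⬝ᵥ (sqMoment M hs f *ᵥ u) = ∑ z, (∑ a, u a * nextLogit M (hs a ++ f) z) ^ 2 := by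
  rw [sqMoment, ← Matrix.mulVec_mulVec, Matrix.dotProduct_mulVec, Matrix.mulVec_transpose]
  simp [dotProduct, Matrix.vecMul, logitMat, sq]

lemma dotProduct_unifMoment_mulVec (M : List S → S → ℝ) (hs : ι → List S) (k : ℕ)
    (u : ι → ℝ) :
    u ⬝ᵥ (unifMoment M hs k *ᵥ u) = (1 / (k : ℝ)) * ∑ t ∈ Finset.range k,
      ((1 : ℝ) / (Fintype.card S : ℝ) ^ t) * ∑ f : Fin t → S,
        ∑ z, (∑ a, u a * nextLogit M (hs a ++ List.ofFn f) z) ^ 2 := by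
  have h : unifMoment M hs k = (1 / (k : ℝ)) • ∑ t ∈ Finset.range k,
      ((1 : ℝ) / (Fintype.card S : ℝ) ^ t) • ∑ f : Fin t → S,
        sqMoment M hs (List.ofFn f) := by
    ext a b
    simp [unifMoment, Matrix.sum_apply]
  simp only [h, Matrix.smul_mulVec, Matrix.sum_mulVec, dotProduct_smul, dotProduct_sum,
    dotProduct_sqMoment_mulVec, smul_eq_mul]

lemma dotProduct_modelMoment_mulVec (M : List S → S → ℝ) (hs : ι → List S) (h0 : List S)
    (k : ℕ) (u : ι → ℝ) :
    u ⬝ᵥ (modelMoment M hs h0 k *ᵥ u) = (1 / (k : ℝ)) * ∑ t ∈ Finset.range k,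
      ∑ f : Fin t → S, contProb M h0 f *
        ∑ z, (∑ a, u a * nextLogit M (hs a ++ List.ofFn f) z) ^ 2 := by
  have h : modelMoment M hs h0 k = (1 / (k : ℝ)) • ∑ t ∈ Finset.range k,
      ∑ f : Fin t → S, contProb M h0 f • sqMoment M hs (List.ofFn f) := by
    ext a b
    simp [modelMoment, Matrix.sum_apply]
  simp only [h, Matrix.smul_mulVec, Matrix.sum_mulVec, dotProduct_smul, dotProduct_sum,
    dotProduct_sqMoment_mulVec, smul_eq_mul]

end Moments

section Coverage

variable {S : Type*} [Fintype S]

/-- Matrix coverage transfers the regression error from uniform futures to futures drawn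
from the model. -/
lemma model_regression_error_le {n k : ℕ} {M : List S → S → ℝ} {h0 : List S}
    {hs : Fin n → List S} {α γ Δ : ℝ} (hα : 0 ≤ α)
    (hcov : (α • unifMoment M (Fin.cons h0 hs) k
        + γ • (1 : Matrix (Fin (n + 1)) (Fin (n + 1)) ℝ)
        - modelMoment M (Fin.cons h0 hs) h0 k).PosSemidef)
    (v : Fin n → ℝ)
    (hreg : (1 / (k : ℝ)) * ∑ t ∈ Finset.range k,
        ((1 : ℝ) / (Fintype.card S : ℝ) ^ t) * ∑ f : Fin t → S, ∑ z : S,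
          (nextLogit M (h0 ++ List.ofFn f) z
            - ∑ i, v i * nextLogit M (hs i ++ List.ofFn f) z) ^ 2 ≤ Δ) :
    (1 / (k : ℝ)) * ∑ t ∈ Finset.range k, ∑ f : Fin t → S, contProb M h0 f * ∑ z : S,
        (nextLogit M (h0 ++ List.ofFn f) z
          - ∑ i, v i * nextLogit M (hs i ++ List.ofFn f) z) ^ 2
      ≤ α * Δ + γ * (1 + ∑ i, (v i) ^ 2) := by
  set u : Fin (n + 1) → ℝ := Fin.cons 1 (fun i => -v i) with hu
  have hres : ∀ (f : List S) (z : S),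
      ∑ a, u a * nextLogit M ((Fin.cons h0 hs : Fin (n + 1) → List S) a ++ f) z =
        nextLogit M (h0 ++ f) z - ∑ i, v i * nextLogit M (hs i ++ f) z := fun f z => by
    simp [hu, Fin.sum_univ_succ, sub_eq_add_neg]
  have hnorm : u ⬝ᵥ u = 1 + ∑ i, (v i) ^ 2 := by
    simp [hu, dotProduct, Fin.sum_univ_succ, sq]
  have h := hcov.dotProduct_mulVec_nonneg u
  simp only [star_trivial, Matrix.sub_mulVec, Matrix.add_mulVec, Matrix.smul_mulVec,
    Matrix.one_mulVec, dotProduct_sub, dotProduct_add, dotProduct_smul, smul_eq_mul,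
    dotProduct_unifMoment_mulVec, dotProduct_modelMoment_mulVec, hres, hnorm] at h
  linarith [mul_le_mul_of_nonneg_left hreg hα]

end Coverage

/-- under the hypotheses of the LinGen generalization lemma, if
additionally the mean-centered logits of `M` are bounded by `C` in absolute value,
then the reversed KL divergence satisfies
`KL(P_LinGen ‖ P_truth) ≤ 2 (1 + k(log|Σ| + 2C)) √k (αΔ + γ(1 + ‖v‖²))^{1/4}`. -/
theorem stmt_15 {S : Type*} [Fintype S] [DecidableEq S] (n k : ℕ)
    (M : List S → S → ℝ) (hfull : ∀ y z, 0 < M y z) (hsum : ∀ y, ∑ z, M y z = 1)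
    (C : ℝ) (hC : ∀ (h : List S) (z : S), |nextLogit M h z| ≤ C)
    (h0 : List S) (hs : Fin n → List S) (α γ : ℝ) (hα : 0 ≤ α) (hγ : 0 ≤ γ)
    (hcov : (α • unifMoment M (Fin.cons h0 hs) k
        + γ • (1 : Matrix (Fin (n + 1)) (Fin (n + 1)) ℝ)
        - modelMoment M (Fin.cons h0 hs) h0 k).PosSemidef)
    (v : Fin n → ℝ) (Δ : ℝ)
    (hreg : (1 / (k : ℝ)) * ∑ t ∈ Finset.range k,
        ((1 : ℝ) / (Fintype.card S : ℝ) ^ t) * ∑ f : Fin t → S, ∑ z : S,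
          (nextLogit M (h0 ++ List.ofFn f) z
            - ∑ i, v i * nextLogit M (hs i ++ List.ofFn f) z) ^ 2 ≤ Δ) :
    klSeq k (lingenProb M hs v k) (truthProb M h0 k)
      ≤ 2 * (1 + k * (Real.log (Fintype.card S) + 2 * C)) * Real.sqrt k
          * (α * Δ + γ * (1 + ∑ i, (v i) ^ 2)) ^ ((1 : ℝ) / 4) := by
  have hS : Nonempty S := by
    by_contra h
    have : IsEmpty S := not_nonempty_iff.1 h
    simpa using hsum []
  rcases Nat.eq_zero_or_pos k with rfl | hk
  · simp [klSeq, lingenProb, truthProb]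
  have hkR : (0 : ℝ) < k := Nat.cast_pos.2 hk
  set p : List S → S → ℝ := fun y => M (h0 ++ y)
  set q : List S → S → ℝ :=
    fun y => softmaxF fun z => ∑ i, v i * nextLogit M (hs i ++ y) z
  have hp0 : ∀ y z, 0 < p y z := fun y z => hfull _ z
  have hq0 : ∀ y z, 0 < q y z := fun y z => softmaxF_pos_s15 _ z
  have hp1 : ∀ y, ∑ z, p y z = 1 := fun y => hsum _
  have hq1 : ∀ y, ∑ z, q y z = 1 := fun y => sum_softmaxF_s15 _
  have hL : lingenProb M hs v k = seqProb q := rfl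
  have hT : truthProb M h0 k = seqProb p := rfl
  rw [hL, hT]
  have hpsm : ∀ y, p y = softmaxF (nextLogit M (h0 ++ y)) :=
    fun y => (softmaxF_nextLogit hfull hsum _).symm
  have hP0 : ∀ w : Fin k → S, 0 < seqProb p w := seqProb_pos hp0
  have hQ0 : ∀ w : Fin k → S, 0 < seqProb q w := seqProb_pos hq0
  have hP1 := sum_seqProb hp1 k
  have hQ1 := sum_seqProb hq1 k
  set E := α * Δ + γ * (1 + ∑ i, (v i) ^ 2)
  have herr := model_regression_error_le hα hcov v hreg
  set D : List S → ℝ := fun y => ∑ z, (nextLogit M (h0 ++ y) z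
    - ∑ i, v i * nextLogit M (hs i ++ y) z) ^ 2
  have herr' : ∑ t ∈ Finset.range k, ∑ f : Fin t → S, seqProb p f * D (List.ofFn f)
      ≤ k * E := by
    rw [one_div, inv_mul_le_iff₀ hkR] at herr
    exact herr
  have hE0 : 0 ≤ E := by
    refine nonneg_of_mul_nonneg_right (le_trans ?_ herr') hkR
    exact Finset.sum_nonneg fun t _ => Finset.sum_nonneg fun f _ =>
      mul_nonneg (seqProb_pos hp0 f).le (Finset.sum_nonneg fun _ _ => sq_nonneg _)
  have hforward : klSeq k (seqProb p) (seqProb q) ≤ 2 * (k * E) := by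
    rw [klSeq_seqProb hp0 hq0 hp1]
    refine le_trans ?_ (mul_le_mul_of_nonneg_left herr' zero_le_two)
    simp only [Finset.mul_sum (Finset.range k), Finset.mul_sum Finset.univ _ (2 : ℝ)]
    refine Finset.sum_le_sum fun t _ => Finset.sum_le_sum fun f _ => ?_
    rw [mul_left_comm]
    refine mul_le_mul_of_nonneg_left ?_ (seqProb_pos hp0 f).le
    rw [hpsm]
    exact sum_softmaxF_mul_log_div_le _ _
  set T := ∑ w : Fin k → S, |seqProb q w - seqProb p w|
  have hTsq : T ^ 2 ≤ 8 * (k * E) := by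
    have h := sum_abs_sub_sq_le hP0 hQ0 hP1 hQ1
    simp_rw [abs_sub_comm (seqProb p _)] at h
    unfold klSeq at hforward
    linarith
  have hT2 : T ≤ 2 := by
    calc T ≤ ∑ w : Fin k → S, (seqProb q w + seqProb p w) :=
          Finset.sum_le_sum fun w _ => abs_le.2
            ⟨by linarith [hP0 w, hQ0 w], by linarith [hP0 w, hQ0 w]⟩
      _ = 2 := by rw [Finset.sum_add_distrib, hP1, hQ1]; norm_num
  have hTV : T / 2 ≤ 2 * √k * E ^ ((1 : ℝ) / 4) := by
    have hk1 : 1 ≤ √(k : ℝ) := Real.one_le_sqrt.2 (by exact_mod_cast hk)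
    rcases le_total E 1 with h1 | h1
    · have hroot : √E ≤ E ^ ((1 : ℝ) / 4) := by
        rw [Real.sqrt_eq_rpow]
        exact Real.rpow_le_rpow_of_exponent_ge_of_imp hE0 h1 (by norm_num) (by norm_num)
      have hTle : T ≤ 4 * (√k * √E) := by
        refine abs_le_of_sq_le_sq' ?_ (by positivity) |>.2
        rw [mul_pow, mul_pow, Real.sq_sqrt hkR.le, Real.sq_sqrt hE0]
        nlinarith [mul_nonneg hkR.le hE0]
      nlinarith [mul_le_mul_of_nonneg_left hroot (Real.sqrt_nonneg (k : ℝ))]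
    · have hroot : 1 ≤ E ^ ((1 : ℝ) / 4) := Real.one_le_rpow h1 (by norm_num)
      nlinarith
  have hC0 : 0 ≤ C := (abs_nonneg _).trans (hC [] hS.some)
  have hlog0 : 0 ≤ Real.log (Fintype.card S) := Real.log_natCast_nonneg _
  have hB0 : 0 ≤ k * (Real.log (Fintype.card S) + 2 * C) := by positivity
  have hB : ∀ w : Fin k → S, Real.log (seqProb q w / seqProb p w) ≤
      k * (Real.log (Fintype.card S) + 2 * C) := fun w => by
    have hQle : seqProb q w ≤ 1 := hQ1 ▸
      Finset.single_le_sum (f := fun w : Fin k → S => seqProb q w)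
        (fun w _ => (hQ0 w).le) (Finset.mem_univ w)
    have hPlog : -Real.log (seqProb p w) ≤ k * (Real.log (Fintype.card S) + 2 * C) := by
      rw [seqProb, Real.log_prod fun t _ => (hp0 _ _).ne', ← Finset.sum_neg_distrib]
      calc _ ≤ ∑ _t : Fin k, (Real.log (Fintype.card S) + 2 * C) := by
            refine Finset.sum_le_sum fun t _ => ?_
            rw [hpsm]
            exact neg_log_softmaxF_le (hC _) _
        _ = _ := by simp [mul_add]
    rw [Real.log_div (hQ0 w).ne' (hP0 w).ne']
    linarith [Real.log_nonpos (hQ0 w).le hQle]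
  calc klSeq k (seqProb q) (seqProb p)
      ≤ (1 + k * (Real.log (Fintype.card S) + 2 * C)) * (T / 2) :=
        sum_mul_log_div_le hQ0 hP0 (hQ1.trans hP1.symm) hB
    _ ≤ (1 + k * (Real.log (Fintype.card S) + 2 * C)) * (2 * √k * E ^ ((1 : ℝ) / 4)) :=
        mul_le_mul_of_nonneg_left hTV (by linarith)
    _ = _ := by ring
end
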